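/- Let u be a smooth axially symmetric solution of the stationary Navier–Stokes system (ASNS) with smooth axially symmetric pressure p, where u and p are defined on all of ℝ³ and are 2π-periodic in z, u(x) → 0 uniformly as r = |x'| → ∞, and ∫_{−π}^{π}∫₀^∞ |∇u|² r dr dz < ∞. Then u and ∇u are bounded: there is a constant C, depending only on sup_{x₀∈ℝ³}‖u‖_{L⁶(B(x₀,4))} and on the Dirichlet integral, such that |u(x)| ≤ C and |∇u(x)| ≤ C for all x ∈ ℝ³. -/

import Mathlib

open MeasureTheory Real

/-- `∂_r f` for a function `f = f(r,z)`. -/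
noncomputable def pdr (f : ℝ → ℝ → ℝ) (r z : ℝ) : ℝ := deriv (fun s => f s z) r

/-- `∂_z f` for a function `f = f(r,z)`. -/
noncomputable def pdz (f : ℝ → ℝ → ℝ) (r z : ℝ) : ℝ := deriv (fun t => f r t) z

/-- The axially symmetric stationary Navier–Stokes system (ASNS), imposed for all
`r > 0` and all `z ∈ S`. -/
def ASNS (ur uθ uz p : ℝ → ℝ → ℝ) (S : Set ℝ) : Prop :=
  ∀ r : ℝ, 0 < r → ∀ z ∈ S,
    ((ur r z * pdr ur r z + uz r z * pdz ur r z) - (uθ r z) ^ 2 / r + pdr p r z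
        = pdr (pdr ur) r z + (1 / r) * pdr ur r z + pdz (pdz ur) r z - ur r z / r ^ 2)
    ∧ ((ur r z * pdr uθ r z + uz r z * pdz uθ r z) + ur r z * uθ r z / r
        = pdr (pdr uθ) r z + (1 / r) * pdr uθ r z + pdz (pdz uθ) r z - uθ r z / r ^ 2)
    ∧ ((ur r z * pdr uz r z + uz r z * pdz uz r z) + pdz p r z
        = pdr (pdr uz) r z + (1 / r) * pdr uz r z + pdz (pdz uz) r z)
    ∧ (pdr ur r z + ur r z / r + pdz uz r z = 0)

/-- The Dirichlet integrand `|∇u|²` of an axially symmetric field. -/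
noncomputable def dirE (ur uθ uz : ℝ → ℝ → ℝ) (r z : ℝ) : ℝ :=
  (pdr ur r z) ^ 2 + (pdz ur r z) ^ 2 + (pdr uθ r z) ^ 2 + (pdz uθ r z) ^ 2
    + (pdr uz r z) ^ 2 + (pdz uz r z) ^ 2 + ((ur r z) ^ 2 + (uθ r z) ^ 2) / r ^ 2


/-- The pointwise magnitude of the axially symmetric field `u` as a function on `ℝ³`. -/
noncomputable def mag3 (ur uθ uz : ℝ → ℝ → ℝ) (x : EuclideanSpace ℝ (Fin 3)) : ℝ :=
  Real.sqrt ((ur (Real.sqrt ((x 0) ^ 2 + (x 1) ^ 2)) (x 2)) ^ 2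
    + (uθ (Real.sqrt ((x 0) ^ 2 + (x 1) ^ 2)) (x 2)) ^ 2
    + (uz (Real.sqrt ((x 0) ^ 2 + (x 1) ^ 2)) (x 2)) ^ 2)


/-! ### Helper lemmas -/

/-- One-dimensional differential inequality. -/
lemma ode_aux (H K K' g : ℝ → ℝ) (C E r0 : ℝ) (hC : 0 < C) (hr0 : 1 ≤ r0)
    (hg : ∀ r, r0 ≤ r → 0 ≤ g r)
    (hH : ∀ r, r0 ≤ r → HasDerivAt H (r * g r) r)
    (hK : ∀ r, r0 ≤ r → HasDerivAt K (K' r) r)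
    (hKg : ∀ r, r0 ≤ r → |K r| ≤ C * g r)
    (hE : ∀ r, r0 ≤ r → H r ≤ E)
    (hmain : ∀ r, r0 ≤ r → H r ≤ r * K' r + r * (C * (Real.sqrt (g r) + g r))) :
    H r0 ≤ 0 := by
  by_contra hneg
  push Not at hneg
  set δ := H r0 with hδ
  have mono : ∀ F F' : ℝ → ℝ, ∀ a, r0 ≤ a → (∀ r, a ≤ r → HasDerivAt F (F' r) r) →
      (∀ r, a ≤ r → 0 ≤ F' r) → ∀ r, a ≤ r → F a ≤ F r := by
    intro F F' a ha hF hF' r hr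
    have := monotoneOn_of_deriv_nonneg (convex_Ici a) (f := F)
      (fun x hx => (hF x hx).continuousAt.continuousWithinAt)
      (fun x hx => (hF x (interior_subset hx)).differentiableAt.differentiableWithinAt)
      (fun x hx => by rw [(hF x (interior_subset hx)).deriv]; exact hF' x (interior_subset hx))
    exact this (Set.self_mem_Ici) hr hr
  have hHδ : ∀ r, r0 ≤ r → δ ≤ H r := mono H _ r0 le_rfl hH
    (fun r hr => mul_nonneg (by linarith) (hg r hr))
  set A := C ^ 2 / (2 * δ) + C with hA
  have hApos : 0 < A := by positivity
  have h1 := mono (fun r => K r + A * H r - (δ / 2) * Real.log r)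
    (fun r => K' r + A * (r * g r) - (δ / 2) * r⁻¹) r0 le_rfl
    (fun r hr => ((hK r hr).add ((hH r hr).const_mul A)).sub
      ((Real.hasDerivAt_log (by linarith)).const_mul _))
    (by
      intro r hr
      have hrpos : 0 < r := by linarith
      have hs : Real.sqrt (g r) ^ 2 = g r := Real.sq_sqrt (hg r hr)
      have hs0 := Real.sqrt_nonneg (g r)
      set s := Real.sqrt (g r)
      have a1 := hmain r hr
      have a2 := hHδ r hr
      have a3 : r * (C * s) ≤ δ / 2 + C ^ 2 / (2 * δ) * r ^ 2 * g r := by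
        have : δ / 2 + C ^ 2 / (2 * δ) * r ^ 2 * g r - r * (C * s)
            = (δ - C * r * s) ^ 2 / (2 * δ) := by
          rw [← hs]; field_simp; ring
        have : 0 ≤ (δ - C * r * s) ^ 2 / (2 * δ) := by positivity
        linarith
      have a4 : r * (C * g r) ≤ C * r ^ 2 * g r := by
        have := hg r hr
        have : r * (C * g r) * 1 ≤ r * (C * g r) * r :=
          mul_le_mul_of_nonneg_left (by linarith) (by positivity)
        nlinarith
      have a5 : 0 ≤ r * (K' r + A * (r * g r) - (δ / 2) * r⁻¹) := by
        have : r * (K' r + A * (r * g r) - (δ / 2) * r⁻¹)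
            = r * K' r + (C ^ 2 / (2 * δ) * r ^ 2 * g r + C * r ^ 2 * g r) - δ / 2 := by
          rw [hA]; field_simp
        rw [this]; nlinarith
      exact nonneg_of_mul_nonneg_right a5 hrpos)
  obtain ⟨r1, hr1, hlog⟩ : ∃ r1, r0 ≤ r1 ∧ ∀ r, r1 ≤ r →
      (C + A * E - (K r0 + A * H r0 - (δ / 2) * Real.log r0)) / (δ / 2) ≤ Real.log r := by
    have := Real.tendsto_log_atTop.eventually_ge_atTop
      ((C + A * E - (K r0 + A * H r0 - (δ / 2) * Real.log r0)) / (δ / 2))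
    obtain ⟨a, ha⟩ := Filter.eventually_atTop.1 this
    exact ⟨max a r0, le_max_right _ _, fun r hr => ha r (le_trans (le_max_left _ _) hr)⟩
  have hg1 : ∀ r, r1 ≤ r → 1 ≤ r * g r := by
    intro r hr
    have hr' := hr1.trans hr
    have b1 := hlog r hr
    rw [div_le_iff₀ (by positivity)] at b1
    have b2 := h1 r hr'
    have b3 := mul_le_mul_of_nonneg_left (hE r hr') hApos.le
    have b4 : C ≤ K r := by linarith
    have b5 := hKg r hr'
    have b6 : C * 1 ≤ C * g r := by linarith [le_abs_self (K r)]
    have b7 : 1 ≤ g r := le_of_mul_le_mul_left b6 hC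
    nlinarith
  have h2 := mono (fun r => H r - r) (fun r => r * g r - 1) r1 hr1
    (fun r hr => (hH r (hr1.trans hr)).sub (hasDerivAt_id r))
    (fun r hr => by linarith [hg1 r hr]) (r1 + (E - H r1) + 1)
    (by linarith [hE r1 hr1])
  have := hE (r1 + (E - H r1) + 1) (by linarith [hE r1 hr1])
  linarith

/-- Differentiation under the integral sign. -/
lemma param_deriv (F F' : ℝ → ℝ → ℝ) (a b r : ℝ)
    (hF : Continuous (fun q : ℝ × ℝ => F q.1 q.2))
    (hF' : Continuous (fun q : ℝ × ℝ => F' q.1 q.2))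
    (hd : ∀ s z, HasDerivAt (fun t => F t z) (F' s z) s) :
    HasDerivAt (fun s => ∫ z in a..b, F s z) (∫ z in a..b, F' r z) r := by
  obtain ⟨M, hM⟩ := ((isCompact_Icc (a := r - 1) (b := r + 1)).prod
    (isCompact_uIcc (a := a) (b := b))).exists_bound_of_continuousOn hF'.continuousOn
  have hFc : ∀ s, Continuous (F s) := fun s => hF.comp (Continuous.prodMk_right s)
  have hFc' : ∀ s, Continuous (F' s) := fun s => hF'.comp (Continuous.prodMk_right s)
  refine (intervalIntegral.hasDerivAt_integral_of_dominated_loc_of_deriv_le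
    (s := Set.Icc (r - 1) (r + 1)) (bound := fun _ => M)
    (Icc_mem_nhds (by linarith) (by linarith)) ?_ ((hFc r).intervalIntegrable _ _) ?_ ?_ ?_ ?_).2
  · exact Filter.Eventually.of_forall fun s => (hFc s).aestronglyMeasurable
  · exact (hFc' r).aestronglyMeasurable
  · exact Filter.Eventually.of_forall fun t ht x hx =>
      hM (x, t) ⟨hx, Set.uIoc_subset_uIcc ht⟩
  · exact intervalIntegrable_const
  · exact Filter.Eventually.of_forall fun t _ x _ => hd x t

/-- Cauchy–Schwarz on a period. -/
lemma cs_aux (a : ℝ → ℝ) (G : ℝ) (ha : Continuous a) (hG : ∫ z in (-π)..π, (a z) ^ 2 ≤ G) :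
    ∫ z in (-π)..π, |a z| ≤ 3 * Real.sqrt G := by
  set m := ∫ z in (-π)..π, |a z| with hm
  have hpi := Real.pi_pos
  have hm0 : 0 ≤ m := intervalIntegral.integral_nonneg (by linarith) (fun z _ => abs_nonneg _)
  have i1 : IntervalIntegrable (fun z => (a z) ^ 2) volume (-π) π :=
    (ha.pow 2).intervalIntegrable _ _
  have i2 : IntervalIntegrable (fun z => |a z|) volume (-π) π := ha.abs.intervalIntegrable _ _
  have key : ∀ t : ℝ, 0 ≤ (∫ z in (-π)..π, (a z) ^ 2) - 2 * t * m + 2 * π * t ^ 2 := by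
    intro t
    have h0 : 0 ≤ ∫ z in (-π)..π, ((a z) ^ 2 - 2 * t * |a z| + t ^ 2) := by
      refine intervalIntegral.integral_nonneg (by linarith) (fun z _ => ?_)
      have := sq_nonneg (|a z| - t)
      have h2 := sq_abs (a z)
      nlinarith
    rw [intervalIntegral.integral_add (i1.sub (i2.const_mul _)) intervalIntegrable_const,
      intervalIntegral.integral_sub i1 (i2.const_mul _),
      intervalIntegral.integral_const_mul, intervalIntegral.integral_const] at h0
    simp only [smul_eq_mul] at h0
    linarith
  have k := key (m / (2 * π))
  have e : 2 * (m / (2 * π)) * m - 2 * π * (m / (2 * π)) ^ 2 = m ^ 2 / (2 * π) := by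
    field_simp; ring
  have h3 : m ^ 2 / (2 * π) ≤ G := by linarith
  rw [div_le_iff₀ (by positivity)] at h3
  have hG0 : 0 ≤ G := by
    by_contra hh
    push Not at hh
    nlinarith [sq_nonneg m]
  have h4 : m ^ 2 ≤ (3 * Real.sqrt G) ^ 2 := by
    rw [mul_pow, Real.sq_sqrt hG0]
    nlinarith [Real.pi_lt_d2]
  exact abs_le_of_sq_le_sq' h4 (by positivity) |>.2

lemma pdr_hasDerivAt {f : ℝ → ℝ → ℝ} (hf : ContDiff ℝ (⊤ : ℕ∞) (fun q : ℝ × ℝ => f q.1 q.2))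
    (r z : ℝ) : HasDerivAt (fun s => f s z) (pdr f r z) r := by
  have h : ContDiff ℝ (⊤ : ℕ∞) (fun s : ℝ => f s z) :=
    hf.comp (contDiff_id.prodMk contDiff_const : ContDiff ℝ (⊤ : ℕ∞) (fun s : ℝ => (s, z)))
  exact ((h.differentiable (by simp)) r).hasDerivAt

lemma pdz_hasDerivAt {f : ℝ → ℝ → ℝ} (hf : ContDiff ℝ (⊤ : ℕ∞) (fun q : ℝ × ℝ => f q.1 q.2))
    (r z : ℝ) : HasDerivAt (fun t => f r t) (pdz f r z) z := by
  have h : ContDiff ℝ (⊤ : ℕ∞) (fun s : ℝ => f r s) :=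
    hf.comp (contDiff_const.prodMk contDiff_id : ContDiff ℝ (⊤ : ℕ∞) (fun s : ℝ => (r, s)))
  exact ((h.differentiable (by simp)) z).hasDerivAt

lemma pdr_smooth {f : ℝ → ℝ → ℝ} (hf : ContDiff ℝ (⊤ : ℕ∞) (fun q : ℝ × ℝ => f q.1 q.2)) :
    ContDiff ℝ (⊤ : ℕ∞) (fun q : ℝ × ℝ => pdr f q.1 q.2) := by
  have e : (fun q : ℝ × ℝ => pdr f q.1 q.2)
      = fun q => fderiv ℝ (fun q : ℝ × ℝ => f q.1 q.2) q (1, 0) := by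
    funext q
    have h1 : HasFDerivAt (fun q : ℝ × ℝ => f q.1 q.2) _ (q.1, q.2) :=
      ((hf.differentiable (by simp)) q).hasFDerivAt
    have h2 : HasDerivAt (fun s : ℝ => (s, q.2)) (1, 0) q.1 :=
      (hasDerivAt_id q.1).prodMk (hasDerivAt_const _ _)
    exact (h1.comp_hasDerivAt q.1 h2).deriv
  rw [e]
  exact (hf.fderiv_right (m := (⊤ : ℕ∞)) (by simp)).clm_apply contDiff_const

lemma pdz_smooth {f : ℝ → ℝ → ℝ} (hf : ContDiff ℝ (⊤ : ℕ∞) (fun q : ℝ × ℝ => f q.1 q.2)) :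
    ContDiff ℝ (⊤ : ℕ∞) (fun q : ℝ × ℝ => pdz f q.1 q.2) := by
  have e : (fun q : ℝ × ℝ => pdz f q.1 q.2)
      = fun q => fderiv ℝ (fun q : ℝ × ℝ => f q.1 q.2) q (0, 1) := by
    funext q
    have h1 : HasFDerivAt (fun q : ℝ × ℝ => f q.1 q.2) _ (q.1, q.2) :=
      ((hf.differentiable (by simp)) q).hasFDerivAt
    have h2 : HasDerivAt (fun s : ℝ => (q.1, s)) (0, 1) q.2 :=
      (hasDerivAt_const _ _).prodMk (hasDerivAt_id q.2)
    exact (h1.comp_hasDerivAt q.2 h2).deriv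
  rw [e]
  exact (hf.fderiv_right (m := (⊤ : ℕ∞)) (by simp)).clm_apply contDiff_const

lemma pdz_periodic {f : ℝ → ℝ → ℝ} (hf : ∀ r z, f r (z + 2 * π) = f r z) (r z : ℝ) :
    pdz f r (z + 2 * π) = pdz f r z := by
  unfold pdz
  rw [← deriv_comp_add_const]
  simp only [hf]

lemma pdr_periodic {f : ℝ → ℝ → ℝ} (hf : ∀ r z, f r (z + 2 * π) = f r z) (r z : ℝ) :
    pdr f r (z + 2 * π) = pdr f r z := by
  unfold pdr
  simp only [hf]

/-- Oscillation bound on a period. -/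
lemma osc_aux (f f' : ℝ → ℝ) (hf : ∀ z, HasDerivAt f (f' z) z) (hc : Continuous f')
    (z t : ℝ) (hz : z ∈ Set.Icc (-π) π) (ht : t ∈ Set.Icc (-π) π) :
    |f z - f t| ≤ ∫ y in (-π)..π, |f' y| := by
  have hpi := Real.pi_pos
  rw [← intervalIntegral.integral_eq_sub_of_hasDerivAt (fun x _ => hf x)
    (hc.intervalIntegrable t z)]
  have key : ∀ a b, a ≤ b → a ∈ Set.Icc (-π) π → b ∈ Set.Icc (-π) π →
      |∫ y in a..b, f' y| ≤ ∫ y in (-π)..π, |f' y| := by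
    intro a b hab ha hb
    refine (intervalIntegral.abs_integral_le_integral_abs hab).trans ?_
    exact intervalIntegral.integral_mono_interval ha.1 hab hb.2
      (Filter.Eventually.of_forall fun x => abs_nonneg _) (hc.abs.intervalIntegrable _ _)
  rcases le_total t z with h | h
  · exact key t z h ht hz
  · rw [intervalIntegral.integral_symm, abs_neg]
    exact key z t h hz ht

/-- The estimate at a fixed radius, for functions of `z` alone. -/
lemma est_aux (r s : ℝ) (hr : 1 ≤ r) (hs : 0 ≤ s)
    (u v w p ur vr wr wrr wzz wz pz ψ ψr : ℝ → ℝ)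
    (cu : Continuous u) (cv : Continuous v) (cw : Continuous w) (cp : Continuous p)
    (cur : Continuous ur) (cvr : Continuous vr) (cwr : Continuous wr) (cwrr : Continuous wrr)
    (cwzz : Continuous wzz) (cwz : Continuous wz) (cpz : Continuous pz)
    (cψ : Continuous ψ) (cψr : Continuous ψr)
    (dp : ∀ z, HasDerivAt p (pz z) z) (dψ : ∀ z, HasDerivAt ψ (u z) z)
    (dwz : ∀ z, HasDerivAt wz (wzz z) z)
    (eψ : ψ π = ψ (-π)) (ep : p π = p (-π)) (ewz : wz π = wz (-π))
    (hns : ∀ z, (u z * wr z + w z * wz z) + pz z = wrr z + (1 / r) * wr z + wzz z)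
    (bu : ∀ z ∈ Set.Icc (-π) π, |u z| ≤ 1) (bv : ∀ z ∈ Set.Icc (-π) π, |v z| ≤ 1)
    (bw : ∀ z ∈ Set.Icc (-π) π, |w z| ≤ 1) (bus : ∀ z ∈ Set.Icc (-π) π, |u z| ≤ 3 * s)
    (bψ : ∀ z ∈ Set.Icc (-π) π, |ψ z| ≤ 10 * s) (bψr : ∀ z ∈ Set.Icc (-π) π, |ψr z| ≤ 13 * s)
    (iur : ∫ z in (-π)..π, |ur z| ≤ 3 * s) (ivr : ∫ z in (-π)..π, |vr z| ≤ 3 * s)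
    (iwr : ∫ z in (-π)..π, |wr z| ≤ 3 * s) (iwz : ∫ z in (-π)..π, |wz z| ≤ 3 * s) :
    (∫ z in (-π)..π, (r * (u z * ur z + v z * vr z + w z * wr z)
        - r * u z * ((u z ^ 2 + v z ^ 2 + w z ^ 2) / 2 + p z)))
      ≤ r * (∫ z in (-π)..π, (ψr z * wr z + ψ z * wrr z)) + r * (200 * (s + s ^ 2))
    ∧ |∫ z in (-π)..π, ψ z * wr z| ≤ 200 * s ^ 2 := by
  have hpi := Real.pi_pos
  have hpi2 := Real.pi_lt_d2
  have hle : -π ≤ π := by linarith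
  have hr0 : 0 < r := by linarith
  have mulb : ∀ a b α : ℝ, |a| ≤ α → |a * b| ≤ α * |b| := fun a b α h => by
    rw [abs_mul]; exact mul_le_mul_of_nonneg_right h (abs_nonneg _)
  constructor
  · set D : ℝ → ℝ := fun z => (u z * p z + ψ z * pz z) - (u z * wz z + ψ z * wzz z) with hD
    set B : ℝ → ℝ := fun z => |ur z| + |vr z| + (1 + 33 * s) * |wr z| + 13 * s * |wz z|
      + 9 / 2 * s with hB
    have hD0 : ∫ z in (-π)..π, D z = 0 := by
      have := intervalIntegral.integral_eq_sub_of_hasDerivAt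
        (f := fun z => ψ z * p z - ψ z * wz z) (f' := D) (a := -π) (b := π)
        (fun x _ => ((dψ x).mul (dp x)).sub ((dψ x).mul (dwz x)))
        (Continuous.intervalIntegrable (by fun_prop) _ _)
      rw [this, eψ, ep, ewz]; ring
    have hBi : ∫ z in (-π)..π, B z ≤ 200 * (s + s ^ 2) := by
      have : ∫ z in (-π)..π, B z = (∫ z in (-π)..π, |ur z|) + (∫ z in (-π)..π, |vr z|)
          + (1 + 33 * s) * (∫ z in (-π)..π, |wr z|) + 13 * s * (∫ z in (-π)..π, |wz z|)
          + 9 / 2 * s * (2 * π) := by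
        simp only [hB]
        rw [intervalIntegral.integral_add, intervalIntegral.integral_add,
          intervalIntegral.integral_add, intervalIntegral.integral_add,
          intervalIntegral.integral_const_mul, intervalIntegral.integral_const_mul,
          intervalIntegral.integral_const, smul_eq_mul]
        · ring
        all_goals exact Continuous.intervalIntegrable (by fun_prop) _ _
      rw [this]
      have h1 := mul_le_mul_of_nonneg_left iwr (by positivity : 0 ≤ 1 + 33 * s)
      have h2 := mul_le_mul_of_nonneg_left iwz (by positivity : 0 ≤ 13 * s)
      have h3 : 9 / 2 * s * (2 * π) ≤ 9 / 2 * s * (2 * 3.15) := by gcongr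
      nlinarith
    have step : (∫ z in (-π)..π, (r * (u z * ur z + v z * vr z + w z * wr z)
        - r * u z * ((u z ^ 2 + v z ^ 2 + w z ^ 2) / 2 + p z)))
        ≤ ∫ z in (-π)..π, r * (((ψr z * wr z + ψ z * wrr z) - D z) + B z) := by
      refine intervalIntegral.integral_mono_on hle
        (Continuous.intervalIntegrable (by fun_prop) _ _)
        (Continuous.intervalIntegrable (by fun_prop) _ _) (fun z hz => ?_)
      have e1 : ψ z * pz z = ψ z * wrr z + (1 / r) * (ψ z * wr z) + ψ z * wzz z
          - ψ z * (u z * wr z) - ψ z * (w z * wz z) := by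
        linear_combination (ψ z) * hns z
      rw [mul_assoc r (u z), ← mul_sub]
      refine mul_le_mul_of_nonneg_left ?_ hr0.le
      simp only [hD, hB]
      have a1 := abs_le.1 (mulb _ (ur z) _ (bu z hz))
      have a2 := abs_le.1 (mulb _ (vr z) _ (bv z hz))
      have a3 := abs_le.1 (mulb _ (wr z) _ (bw z hz))
      have a4 := abs_le.1 (mulb _ (wr z) _ (bψr z hz))
      have a5 := abs_le.1 (mulb _ (wz z) _ (bus z hz))
      have bψu : |ψ z * u z| ≤ 10 * s := by
        rw [abs_mul]
        have := mul_le_mul (bψ z hz) (bu z hz) (abs_nonneg _) (by positivity)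
        linarith
      have bψw : |ψ z * w z| ≤ 10 * s := by
        rw [abs_mul]
        have := mul_le_mul (bψ z hz) (bw z hz) (abs_nonneg _) (by positivity)
        linarith
      have a6 := abs_le.1 (mulb _ (wr z) _ bψu)
      have a7 := abs_le.1 (mulb _ (wz z) _ bψw)
      have bψ' : |(1 / r) * ψ z| ≤ 10 * s := by
        rw [abs_mul, abs_of_pos (by positivity)]
        have h1 : 1 / r ≤ 1 := by rw [div_le_one hr0]; exact hr
        have := mul_le_mul h1 (bψ z hz) (abs_nonneg _) (by norm_num)
        linarith
      have a8 := abs_le.1 (mulb _ (wr z) _ bψ')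
      have a9 : |u z * ((u z ^ 2 + v z ^ 2 + w z ^ 2) / 2)| ≤ 9 / 2 * s := by
        rw [abs_mul]
        have q1 := (sq_le_one_iff_abs_le_one (u z)).2 (bu z hz)
        have q2 := (sq_le_one_iff_abs_le_one (v z)).2 (bv z hz)
        have q3 := (sq_le_one_iff_abs_le_one (w z)).2 (bw z hz)
        have q4 : |(u z ^ 2 + v z ^ 2 + w z ^ 2) / 2| ≤ 3 / 2 := by
          rw [abs_of_nonneg (by positivity)]; linarith
        have := mul_le_mul (bus z hz) q4 (abs_nonneg _) (by positivity)
        linarith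
      have a9' := abs_le.1 a9
      rw [e1]
      linarith [a1.2, a2.2, a3.2, a4.1, a5.2, a5.1, a6.1, a6.2, a7.1, a7.2, a8.1, a8.2, a9'.1]
    refine step.trans ?_
    rw [intervalIntegral.integral_const_mul, intervalIntegral.integral_add,
      intervalIntegral.integral_sub, hD0, sub_zero, mul_add]
    · gcongr
    all_goals exact Continuous.intervalIntegrable (by fun_prop) _ _
  · refine (intervalIntegral.abs_integral_le_integral_abs hle).trans ?_
    have : ∫ z in (-π)..π, |ψ z * wr z| ≤ ∫ z in (-π)..π, 10 * s * |wr z| := by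
      refine intervalIntegral.integral_mono_on hle
        (Continuous.intervalIntegrable (by fun_prop) _ _)
        (Continuous.intervalIntegrable (by fun_prop) _ _) (fun z hz => mulb _ _ _ (bψ z hz))
    rw [intervalIntegral.integral_const_mul] at this
    have h2 := mul_le_mul_of_nonneg_left iwr (by positivity : 0 ≤ 10 * s)
    nlinarith

/-- Pointwise energy identity, in terms of abstract real numbers. -/
lemma energy_alg (r a b c p ar br cr az bz cz pr pz arr brr crr azz bzz czz : ℝ) (hr : 0 < r)
    (h1 : (a * ar + c * az) - b ^ 2 / r + pr = arr + (1 / r) * ar + azz - a / r ^ 2)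
    (h2 : (a * br + c * bz) + a * b / r = brr + (1 / r) * br + bzz - b / r ^ 2)
    (h3 : (a * cr + c * cz) + pz = crr + (1 / r) * cr + czz)
    (h4 : ar + a / r + cz = 0) :
    (a * ar + b * br + c * cr) + r * (ar ^ 2 + a * arr + br ^ 2 + b * brr + cr ^ 2 + c * crr)
      - (a * ((a ^ 2 + b ^ 2 + c ^ 2) / 2 + p) + r * ar * ((a ^ 2 + b ^ 2 + c ^ 2) / 2 + p)
        + r * a * (a * ar + b * br + c * cr + pr))
    = r * (ar ^ 2 + az ^ 2 + br ^ 2 + bz ^ 2 + cr ^ 2 + cz ^ 2 + (a ^ 2 + b ^ 2) / r ^ 2)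
      - (r * (az ^ 2 + a * azz + bz ^ 2 + b * bzz + cz ^ 2 + c * czz)
        - r * (cz * ((a ^ 2 + b ^ 2 + c ^ 2) / 2 + p)
          + c * (a * az + b * bz + c * cz + pz))) := by
  have hr' : r ≠ 0 := hr.ne'
  field_simp at h1 h2 h3 h4 ⊢
  linear_combination (-2 * a) * h1 + (-2 * b) * h2 + (-2 * r * c) * h3
    + (-2 * r * ((a ^ 2 + b ^ 2 + c ^ 2) / 2 + p)) * h4

/-- Continuous function with vanishing derivative on `(0,∞)`. -/
lemma const_aux (f f' : ℝ → ℝ) (hf : ∀ r, HasDerivAt f (f' r) r) (h0 : ∀ r, 0 < r → f' r = 0)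
    (r : ℝ) (hr : 0 < r) : f r = f 0 := by
  obtain ⟨c, hc, e⟩ := exists_hasDerivAt_eq_slope f f' hr
    (fun x _ => (hf x).continuousAt.continuousWithinAt) (fun x _ => hf x)
  rw [h0 c hc.1] at e
  have hr' : r - 0 ≠ 0 := by simpa using hr.ne'
  rw [eq_div_iff hr'] at e
  linarith

/-- The hypotheses on the solution which are used. -/
structure SolHyp (ur uθ uz p : ℝ → ℝ → ℝ) : Prop where
  sr : ContDiff ℝ (⊤ : ℕ∞) (fun q : ℝ × ℝ => ur q.1 q.2)
  sθ : ContDiff ℝ (⊤ : ℕ∞) (fun q : ℝ × ℝ => uθ q.1 q.2)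
  sz : ContDiff ℝ (⊤ : ℕ∞) (fun q : ℝ × ℝ => uz q.1 q.2)
  sp : ContDiff ℝ (⊤ : ℕ∞) (fun q : ℝ × ℝ => p q.1 q.2)
  pr : ∀ r z : ℝ, ur r (z + 2 * π) = ur r z
  pθ : ∀ r z : ℝ, uθ r (z + 2 * π) = uθ r z
  pz : ∀ r z : ℝ, uz r (z + 2 * π) = uz r z
  pp : ∀ r z : ℝ, p r (z + 2 * π) = p r z
  ns : ASNS ur uθ uz p Set.univ

lemma per_pi {f : ℝ → ℝ → ℝ} (hf : ∀ r z, f r (z + 2 * π) = f r z) (r : ℝ) :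
    f r π = f r (-π) := by
  rw [← hf r (-π)]; congr 1; ring

lemma cont_z {f : ℝ → ℝ → ℝ} (hf : ContDiff ℝ (⊤ : ℕ∞) (fun q : ℝ × ℝ => f q.1 q.2)) (r : ℝ) :
    Continuous (f r) := hf.continuous.comp (Continuous.prodMk_right r)

/-- Energy flux density. -/
noncomputable def hfun (ur uθ uz p : ℝ → ℝ → ℝ) (r z : ℝ) : ℝ :=
  r * (ur r z * pdr ur r z + uθ r z * pdr uθ r z + uz r z * pdr uz r z)
    - r * ur r z * ((ur r z ^ 2 + uθ r z ^ 2 + uz r z ^ 2) / 2 + p r z)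

/-- Radial derivative of the energy flux density. -/
noncomputable def kfun (ur uθ uz p : ℝ → ℝ → ℝ) (r z : ℝ) : ℝ :=
  (ur r z * pdr ur r z + uθ r z * pdr uθ r z + uz r z * pdr uz r z)
    + r * (pdr ur r z ^ 2 + ur r z * pdr (pdr ur) r z + pdr uθ r z ^ 2
      + uθ r z * pdr (pdr uθ) r z + pdr uz r z ^ 2 + uz r z * pdr (pdr uz) r z)
    - (ur r z * ((ur r z ^ 2 + uθ r z ^ 2 + uz r z ^ 2) / 2 + p r z)
      + r * pdr ur r z * ((ur r z ^ 2 + uθ r z ^ 2 + uz r z ^ 2) / 2 + p r z)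
      + r * ur r z * (ur r z * pdr ur r z + uθ r z * pdr uθ r z + uz r z * pdr uz r z
        + pdr p r z))

lemma hfun_deriv {ur uθ uz p : ℝ → ℝ → ℝ} (S : SolHyp ur uθ uz p) (r z : ℝ) :
    HasDerivAt (fun s => hfun ur uθ uz p s z) (kfun ur uθ uz p r z) r := by
  have a := pdr_hasDerivAt S.sr r z
  have b := pdr_hasDerivAt S.sθ r z
  have c := pdr_hasDerivAt S.sz r z
  have q := pdr_hasDerivAt S.sp r z
  have ar := pdr_hasDerivAt (pdr_smooth S.sr) r z
  have br := pdr_hasDerivAt (pdr_smooth S.sθ) r z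
  have cr := pdr_hasDerivAt (pdr_smooth S.sz) r z
  have i := hasDerivAt_id' r
  have := (i.mul (((a.mul ar).add (b.mul br)).add (c.mul cr))).sub
    ((i.mul a).mul (((((a.pow 2).add (b.pow 2)).add (c.pow 2)).div_const 2).add q))
  refine this.congr_deriv ?_
  simp only [kfun, Pi.mul_apply, Pi.add_apply, Pi.pow_apply]
  push_cast
  ring

lemma hfun_cont {ur uθ uz p : ℝ → ℝ → ℝ} (S : SolHyp ur uθ uz p) :
    Continuous (fun q : ℝ × ℝ => hfun ur uθ uz p q.1 q.2) := by
  have a := S.sr.continuous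
  have b := S.sθ.continuous
  have c := S.sz.continuous
  have q := S.sp.continuous
  have ar := (pdr_smooth S.sr).continuous
  have br := (pdr_smooth S.sθ).continuous
  have cr := (pdr_smooth S.sz).continuous
  unfold hfun
  fun_prop

lemma kfun_cont {ur uθ uz p : ℝ → ℝ → ℝ} (S : SolHyp ur uθ uz p) :
    Continuous (fun q : ℝ × ℝ => kfun ur uθ uz p q.1 q.2) := by
  have a := S.sr.continuous
  have b := S.sθ.continuous
  have c := S.sz.continuous
  have q := S.sp.continuous
  have ar := (pdr_smooth S.sr).continuous
  have br := (pdr_smooth S.sθ).continuous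
  have cr := (pdr_smooth S.sz).continuous
  have qr := (pdr_smooth S.sp).continuous
  have arr := (pdr_smooth (pdr_smooth S.sr)).continuous
  have brr := (pdr_smooth (pdr_smooth S.sθ)).continuous
  have crr := (pdr_smooth (pdr_smooth S.sz)).continuous
  unfold kfun
  fun_prop

lemma dirE_cont {ur uθ uz p : ℝ → ℝ → ℝ} (S : SolHyp ur uθ uz p) (r : ℝ) :
    Continuous (fun z => dirE ur uθ uz r z) := by
  have a := cont_z S.sr r
  have b := cont_z S.sθ r
  have c := cont_z S.sz r
  have ar := cont_z (pdr_smooth S.sr) r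
  have br := cont_z (pdr_smooth S.sθ) r
  have cr := cont_z (pdr_smooth S.sz) r
  have az := cont_z (pdz_smooth S.sr) r
  have bz := cont_z (pdz_smooth S.sθ) r
  have cz := cont_z (pdz_smooth S.sz) r
  unfold dirE
  fun_prop

lemma dirE_nonneg (ur uθ uz : ℝ → ℝ → ℝ) (r z : ℝ) : 0 ≤ dirE ur uθ uz r z := by
  unfold dirE; positivity

lemma int_kfun {ur uθ uz p : ℝ → ℝ → ℝ} (S : SolHyp ur uθ uz p) (r : ℝ) (hr : 0 < r) :
    ∫ z in (-π)..π, kfun ur uθ uz p r z = r * ∫ z in (-π)..π, dirE ur uθ uz r z := by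
  have a := cont_z S.sr r
  have b := cont_z S.sθ r
  have c := cont_z S.sz r
  have q := cont_z S.sp r
  have az := cont_z (pdz_smooth S.sr) r
  have bz := cont_z (pdz_smooth S.sθ) r
  have cz := cont_z (pdz_smooth S.sz) r
  have qz := cont_z (pdz_smooth S.sp) r
  have azz := cont_z (pdz_smooth (pdz_smooth S.sr)) r
  have bzz := cont_z (pdz_smooth (pdz_smooth S.sθ)) r
  have czz := cont_z (pdz_smooth (pdz_smooth S.sz)) r
  set W : ℝ → ℝ := fun z =>
    (r * (pdz ur r z ^ 2 + ur r z * pdz (pdz ur) r z + pdz uθ r z ^ 2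
      + uθ r z * pdz (pdz uθ) r z + pdz uz r z ^ 2 + uz r z * pdz (pdz uz) r z)
      - r * (pdz uz r z * ((ur r z ^ 2 + uθ r z ^ 2 + uz r z ^ 2) / 2 + p r z)
          + uz r z * (ur r z * pdz ur r z + uθ r z * pdz uθ r z + uz r z * pdz uz r z
            + pdz p r z))) with hW
  have cW : Continuous W := by fun_prop
  have hW0 : ∫ z in (-π)..π, W z = 0 := by
    have := intervalIntegral.integral_eq_sub_of_hasDerivAt
      (f := fun z => r * (ur r z * pdz ur r z + uθ r z * pdz uθ r z + uz r z * pdz uz r z)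
        - r * (uz r z * ((ur r z ^ 2 + uθ r z ^ 2 + uz r z ^ 2) / 2 + p r z)))
      (f' := W) (a := -π) (b := π) (fun z _ => by
        have a := pdz_hasDerivAt S.sr r z
        have b := pdz_hasDerivAt S.sθ r z
        have c := pdz_hasDerivAt S.sz r z
        have q := pdz_hasDerivAt S.sp r z
        have az := pdz_hasDerivAt (pdz_smooth S.sr) r z
        have bz := pdz_hasDerivAt (pdz_smooth S.sθ) r z
        have cz := pdz_hasDerivAt (pdz_smooth S.sz) r z
        have := ((((a.mul az).add (b.mul bz)).add (c.mul cz)).const_mul r).sub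
          ((c.mul (((((a.pow 2).add (b.pow 2)).add (c.pow 2)).div_const 2).add q)).const_mul r)
        refine this.congr_deriv ?_
        simp only [hW, Pi.add_apply, Pi.pow_apply]
        push_cast
        ring) (cW.intervalIntegrable _ _)
    rw [this, per_pi S.pr, per_pi S.pθ, per_pi S.pz, per_pi S.pp,
      per_pi (pdz_periodic S.pr), per_pi (pdz_periodic S.pθ), per_pi (pdz_periodic S.pz)]
    ring
  have e : ∀ z, kfun ur uθ uz p r z = r * dirE ur uθ uz r z - W z := by
    intro z
    obtain ⟨h1, h2, h3, h4⟩ := S.ns r hr z (Set.mem_univ _)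
    exact energy_alg _ _ _ _ _ _ _ _ _ _ _ _ _ _ _ _ _ _ _ hr h1 h2 h3 h4
  simp only [e]
  rw [intervalIntegral.integral_sub, hW0, sub_zero, intervalIntegral.integral_const_mul]
  · exact ((dirE_cont S r).const_mul r).intervalIntegrable _ _
  · exact cW.intervalIntegrable _ _

lemma flux_zero {ur uθ uz p : ℝ → ℝ → ℝ} (S : SolHyp ur uθ uz p) (r : ℝ) (hr : 0 < r) :
    ∫ z in (-π)..π, ur r z = 0 := by
  have a := S.sr.continuous
  have ar := (pdr_smooth S.sr).continuous
  have key := const_aux (fun r => ∫ z in (-π)..π, r * ur r z)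
    (fun r => ∫ z in (-π)..π, (ur r z + r * pdr ur r z))
    (fun r => param_deriv (fun r z => r * ur r z) (fun r z => ur r z + r * pdr ur r z) _ _ r
      (by fun_prop) (by fun_prop) (fun s z => by
        have := (hasDerivAt_id' s).mul (pdr_hasDerivAt S.sr s z)
        exact this.congr_deriv (by ring)))
    (fun r hr => by
      have e : ∀ z, ur r z + r * pdr ur r z = (-r) * pdz uz r z := by
        intro z
        obtain ⟨-, -, -, h4⟩ := S.ns r hr z (Set.mem_univ _)
        field_simp at h4
        linear_combination h4
      simp only [e]
      rw [intervalIntegral.integral_const_mul,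
        intervalIntegral.integral_eq_sub_of_hasDerivAt (fun z _ => pdz_hasDerivAt S.sz r z)
          ((cont_z (pdz_smooth S.sz) r).intervalIntegrable _ _), per_pi S.pz]
      ring) r hr
  simp only [intervalIntegral.integral_const_mul, zero_mul, intervalIntegral.integral_zero] at key
  exact (mul_eq_zero.1 key).resolve_left (ne_of_gt hr)

/-- Estimates at radius `r`. -/
lemma est_main {ur uθ uz p : ℝ → ℝ → ℝ} (S : SolHyp ur uθ uz p) (r : ℝ) (hr : 1 ≤ r)
    (hb : ∀ z, |ur r z| + |uθ r z| + |uz r z| < 1) (g : ℝ)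
    (hg : g = ∫ z in (-π)..π, dirE ur uθ uz r z) :
    (∫ z in (-π)..π, hfun ur uθ uz p r z)
      ≤ r * (∫ z in (-π)..π, ((∫ t in (0:ℝ)..z, pdr ur r t) * pdr uz r z
          + (∫ t in (0:ℝ)..z, ur r t) * pdr (pdr uz) r z))
        + r * (200 * (Real.sqrt g + g))
    ∧ |∫ z in (-π)..π, (∫ t in (0:ℝ)..z, ur r t) * pdr uz r z| ≤ 200 * g := by
  have hr0 : 0 < r := by linarith
  have hpi := Real.pi_pos
  have hpi2 := Real.pi_lt_d2
  have hle : -π ≤ π := by linarith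
  have hg0 : 0 ≤ g := by
    rw [hg]; exact intervalIntegral.integral_nonneg hle (fun z _ => dirE_nonneg _ _ _ _ _)
  have a := cont_z S.sr r
  have b := cont_z S.sθ r
  have c := cont_z S.sz r
  have ar := cont_z (pdr_smooth S.sr) r
  have br := cont_z (pdr_smooth S.sθ) r
  have cr := cont_z (pdr_smooth S.sz) r
  have az := cont_z (pdz_smooth S.sr) r
  have cz := cont_z (pdz_smooth S.sz) r
  set s := Real.sqrt g with hs
  have hs0 : 0 ≤ s := Real.sqrt_nonneg _
  have hsg : g = s ^ 2 := (Real.sq_sqrt hg0).symm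
  have cs : ∀ f : ℝ → ℝ, Continuous f → (∀ z, f z ^ 2 ≤ dirE ur uθ uz r z) →
      ∫ z in (-π)..π, |f z| ≤ 3 * s := by
    intro f hf hfE
    refine cs_aux f g hf ?_
    rw [hg]
    exact intervalIntegral.integral_mono_on hle ((hf.pow 2).intervalIntegrable _ _)
      ((dirE_cont S r).intervalIntegrable _ _) (fun z _ => hfE z)
  have nn : ∀ z, 0 ≤ (ur r z ^ 2 + uθ r z ^ 2) / r ^ 2 := fun z => by positivity
  have iar := cs _ ar (fun z => by unfold dirE; nlinarith [nn z])
  have ibr := cs _ br (fun z => by unfold dirE; nlinarith [nn z])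
  have icr := cs _ cr (fun z => by unfold dirE; nlinarith [nn z])
  have iaz := cs _ az (fun z => by unfold dirE; nlinarith [nn z])
  have icz := cs _ cz (fun z => by unfold dirE; nlinarith [nn z])
  have bus : ∀ z ∈ Set.Icc (-π) π, |ur r z| ≤ 3 * s := by
    intro z hz
    have h1 : ∀ t ∈ Set.Icc (-π) π, |ur r z - ur r t| ≤ 3 * s := fun t ht =>
      (osc_aux _ _ (pdz_hasDerivAt S.sr r) az z t hz ht).trans iaz
    have h2 : 0 ≤ ∫ t in (-π)..π, (3 * s - ur r z + ur r t) :=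
      intervalIntegral.integral_nonneg hle (fun t ht => by linarith [(abs_le.1 (h1 t ht)).2])
    have h3 : 0 ≤ ∫ t in (-π)..π, (3 * s + ur r z - ur r t) :=
      intervalIntegral.integral_nonneg hle (fun t ht => by linarith [(abs_le.1 (h1 t ht)).1])
    rw [intervalIntegral.integral_add intervalIntegrable_const (a.intervalIntegrable _ _),
      flux_zero S r hr0, intervalIntegral.integral_const, smul_eq_mul] at h2
    rw [intervalIntegral.integral_sub intervalIntegrable_const (a.intervalIntegrable _ _),
      flux_zero S r hr0, intervalIntegral.integral_const, smul_eq_mul] at h3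
    have h2' : 0 ≤ 3 * s - ur r z :=
      nonneg_of_mul_nonneg_right (by linarith) (by linarith : 0 < π - -π)
    have h3' : 0 ≤ 3 * s + ur r z :=
      nonneg_of_mul_nonneg_right (by linarith) (by linarith : 0 < π - -π)
    exact abs_le.2 ⟨by linarith, by linarith⟩
  have sub : ∀ z ∈ Set.Icc (-π) π, ∀ t ∈ Set.uIoc 0 z, t ∈ Set.Icc (-π) π := by
    intro z hz t ht
    have h0 : (0:ℝ) ∈ Set.Icc (-π) π := ⟨by linarith, by linarith⟩
    exact (Set.uIcc_subset_Icc h0 hz) (Set.uIoc_subset_uIcc ht)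
  have bψ : ∀ z ∈ Set.Icc (-π) π, |∫ t in (0:ℝ)..z, ur r t| ≤ 10 * s := by
    intro z hz
    have := intervalIntegral.norm_integral_le_of_norm_le_const (f := ur r) (a := 0) (b := z)
      (C := 3 * s) (fun t ht => bus t (sub z hz t ht))
    rw [Real.norm_eq_abs] at this
    refine this.trans ?_
    have hz' : |z - 0| ≤ 3.15 := by
      rw [sub_zero]; exact (abs_le.2 ⟨hz.1, hz.2⟩).trans (by linarith)
    nlinarith
  have eψr : ∀ z, (∫ t in (0:ℝ)..z, pdr ur r t)
      = (-(1 / r)) * (∫ t in (0:ℝ)..z, ur r t) - (uz r z - uz r 0) := by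
    intro z
    rw [← intervalIntegral.integral_eq_sub_of_hasDerivAt (fun z _ => pdz_hasDerivAt S.sz r z)
          (cz.intervalIntegrable _ _), ← intervalIntegral.integral_const_mul,
        ← intervalIntegral.integral_sub ((a.const_mul _).intervalIntegrable _ _)
          (cz.intervalIntegrable _ _)]
    congr 1
    funext t
    obtain ⟨-, -, -, h4⟩ := S.ns r hr0 t (Set.mem_univ _)
    linear_combination h4
  have bψr : ∀ z ∈ Set.Icc (-π) π, |∫ t in (0:ℝ)..z, pdr ur r t| ≤ 13 * s := by
    intro z hz
    rw [eψr z]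
    have h0 : (0:ℝ) ∈ Set.Icc (-π) π := ⟨by linarith, by linarith⟩
    have h1 := (osc_aux _ _ (pdz_hasDerivAt S.sz r) cz z 0 hz h0).trans icz
    have h2 : |(-(1 / r)) * (∫ t in (0:ℝ)..z, ur r t)| ≤ 10 * s := by
      rw [abs_mul, abs_neg, abs_of_pos (by positivity)]
      have h1 : 1 / r ≤ 1 := by rw [div_le_one hr0]; exact hr
      have := mul_le_mul h1 (bψ z hz) (abs_nonneg _) (by norm_num)
      linarith
    have := abs_sub ((-(1 / r)) * (∫ t in (0:ℝ)..z, ur r t)) (uz r z - uz r 0)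
    linarith
  have dψ : ∀ z, HasDerivAt (fun z => ∫ t in (0:ℝ)..z, ur r t) (ur r z) z := fun z =>
    intervalIntegral.integral_hasDerivAt_right (a.intervalIntegrable _ _)
      (a.stronglyMeasurableAtFilter _ _) a.continuousAt
  have dψ' : ∀ z, HasDerivAt (fun z => ∫ t in (0:ℝ)..z, pdr ur r t) (pdr ur r z) z := fun z =>
    intervalIntegral.integral_hasDerivAt_right (ar.intervalIntegrable _ _)
      (ar.stronglyMeasurableAtFilter _ _) ar.continuousAt
  have main := est_aux r s hr hs0 (ur r) (uθ r) (uz r) (p r) (pdr ur r) (pdr uθ r) (pdr uz r)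
    (pdr (pdr uz) r) (pdz (pdz uz) r) (pdz uz r) (pdz p r)
    (fun z => ∫ t in (0:ℝ)..z, ur r t) (fun z => ∫ t in (0:ℝ)..z, pdr ur r t)
    a b c (cont_z S.sp r) ar br cr (cont_z (pdr_smooth (pdr_smooth S.sz)) r)
    (cont_z (pdz_smooth (pdz_smooth S.sz)) r) cz (cont_z (pdz_smooth S.sp) r)
    (continuous_iff_continuousAt.2 fun z => (dψ z).continuousAt)
    (continuous_iff_continuousAt.2 fun z => (dψ' z).continuousAt)
    (pdz_hasDerivAt S.sp r) dψ (pdz_hasDerivAt (pdz_smooth S.sz) r)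
    (by
      have := intervalIntegral.integral_interval_sub_left (μ := volume) (f := ur r)
        (a := 0) (b := π) (c := -π) (a.intervalIntegrable _ _) (a.intervalIntegrable _ _)
      rw [flux_zero S r hr0] at this
      exact sub_eq_zero.1 this)
    (per_pi S.pp r) (per_pi (pdz_periodic S.pz) r)
    (fun z => (S.ns r hr0 z (Set.mem_univ _)).2.2.1)
    (fun z _ => by linarith [hb z, abs_nonneg (ur r z), abs_nonneg (uθ r z), abs_nonneg (uz r z)])
    (fun z _ => by linarith [hb z, abs_nonneg (ur r z), abs_nonneg (uθ r z), abs_nonneg (uz r z)])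
    (fun z _ => by linarith [hb z, abs_nonneg (ur r z), abs_nonneg (uθ r z), abs_nonneg (uz r z)])
    bus bψ bψr iar ibr icr icz
  rw [← hsg] at main
  exact main

lemma energy_bound {ur uθ uz p : ℝ → ℝ → ℝ} (S : SolHyp ur uθ uz p) (E : ℝ)
    (hE : ∫⁻ q in Set.Ioi (0:ℝ) ×ˢ Set.Icc (-π) π,
          ENNReal.ofReal (dirE ur uθ uz q.1 q.2 * q.1) ≤ ENNReal.ofReal E)
    (R : ℝ) (hR : 0 < R) : ∫ z in (-π)..π, hfun ur uθ uz p R z ≤ max E 0 := by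
  have hpi := Real.pi_pos
  have hle : -π ≤ π := by linarith
  have hd : ∀ r, HasDerivAt (fun s => ∫ z in (-π)..π, hfun ur uθ uz p s z)
      (∫ z in (-π)..π, kfun ur uθ uz p r z) r := fun r =>
    param_deriv _ _ _ _ r (hfun_cont S) (kfun_cont S) (hfun_deriv S)
  have hc : Continuous (fun r => ∫ z in (-π)..π, kfun ur uθ uz p r z) :=
    intervalIntegral.continuous_parametric_intervalIntegral_of_continuous' (kfun_cont S) _ _
  have h0 : ∫ z in (-π)..π, hfun ur uθ uz p 0 z = 0 := by simp [hfun]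
  have e := intervalIntegral.integral_eq_sub_of_hasDerivAt (a := 0) (b := R)
    (fun r _ => hd r) (hc.intervalIntegrable _ _)
  simp only [h0, sub_zero] at e
  rw [← e]
  have e2 : ∫ r in (0:ℝ)..R, ∫ z in (-π)..π, kfun ur uθ uz p r z
      = ∫ r in Set.Ioc 0 R, ∫ z in (-π)..π, kfun ur uθ uz p r z :=
    intervalIntegral.integral_of_le hR.le
  have eg : ∀ r ∈ Set.Ioc 0 R, (∫ z in (-π)..π, kfun ur uθ uz p r z)
      = ∫ z in Set.Ioc (-π) π, dirE ur uθ uz r z * r := by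
    intro r hr
    rw [int_kfun S r hr.1, ← intervalIntegral.integral_of_le hle,
      intervalIntegral.integral_mul_const, mul_comm]
  have hnn : ∀ r ∈ Set.Ioc 0 R, 0 ≤ ∫ z in (-π)..π, kfun ur uθ uz p r z := by
    intro r hr
    rw [int_kfun S r hr.1]
    exact mul_nonneg hr.1.le
      (intervalIntegral.integral_nonneg hle (fun z _ => dirE_nonneg _ _ _ _ _))
  have hmeas : Measurable (fun q : ℝ × ℝ => ENNReal.ofReal (dirE ur uθ uz q.1 q.2 * q.1)) := by
    have a := S.sr.continuous.measurable
    have b := S.sθ.continuous.measurable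
    have c := S.sz.continuous.measurable
    have ar := (pdr_smooth S.sr).continuous.measurable
    have br := (pdr_smooth S.sθ).continuous.measurable
    have cr := (pdr_smooth S.sz).continuous.measurable
    have az := (pdz_smooth S.sr).continuous.measurable
    have bz := (pdz_smooth S.sθ).continuous.measurable
    have cz := (pdz_smooth S.sz).continuous.measurable
    unfold dirE
    fun_prop
  have key : ENNReal.ofReal (∫ r in (0:ℝ)..R, ∫ z in (-π)..π, kfun ur uθ uz p r z)
      ≤ ENNReal.ofReal E := by
    refine le_trans ?_ hE
    rw [e2, ofReal_integral_eq_lintegral_ofReal (hc.integrableOn_Ioc)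
      ((ae_restrict_iff' measurableSet_Ioc).2 (Filter.Eventually.of_forall hnn))]
    calc ∫⁻ r in Set.Ioc 0 R, ENNReal.ofReal (∫ z in (-π)..π, kfun ur uθ uz p r z)
        = ∫⁻ r in Set.Ioc 0 R, ∫⁻ z in Set.Ioc (-π) π,
            ENNReal.ofReal (dirE ur uθ uz r z * r) := by
          refine setLIntegral_congr_fun measurableSet_Ioc (fun r hr => ?_)
          rw [eg r hr, ofReal_integral_eq_lintegral_ofReal
            (((dirE_cont S r).mul_const r).integrableOn_Ioc)
            (Filter.Eventually.of_forall fun z => mul_nonneg (dirE_nonneg _ _ _ _ _) hr.1.le)]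
      _ = ∫⁻ q in Set.Ioc 0 R ×ˢ Set.Ioc (-π) π,
            ENNReal.ofReal (dirE ur uθ uz q.1 q.2 * q.1) := by
          rw [Measure.volume_eq_prod, ← Measure.prod_restrict,
            lintegral_prod _ hmeas.aemeasurable]
      _ ≤ _ := lintegral_mono_set (Set.prod_mono Set.Ioc_subset_Ioi_self Set.Ioc_subset_Icc_self)
  rcases le_total E 0 with h | h
  · rw [ENNReal.ofReal_of_nonpos h] at key
    have := ENNReal.ofReal_eq_zero.1 (le_antisymm key bot_le)
    exact this.trans (le_max_right _ _)
  · exact ((ENNReal.ofReal_le_ofReal_iff h).1 key).trans (le_max_left _ _)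

/-- Liouville theorem: the Dirichlet integrand vanishes. -/
lemma dirE_zero {ur uθ uz p : ℝ → ℝ → ℝ} (S : SolHyp ur uθ uz p) (E : ℝ)
    (hdec : ∀ ε : ℝ, 0 < ε → ∃ R : ℝ, ∀ r : ℝ, R ≤ r → ∀ z : ℝ,
          |ur r z| + |uθ r z| + |uz r z| < ε)
    (hE : ∫⁻ q in Set.Ioi (0:ℝ) ×ˢ Set.Icc (-π) π,
          ENNReal.ofReal (dirE ur uθ uz q.1 q.2 * q.1) ≤ ENNReal.ofReal E)
    (r z : ℝ) (hr : 0 < r) : dirE ur uθ uz r z = 0 := by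
  have hpi := Real.pi_pos
  have hle : -π ≤ π := by linarith
  obtain ⟨R, hR⟩ := hdec 1 one_pos
  set H : ℝ → ℝ := fun s => ∫ z in (-π)..π, hfun ur uθ uz p s z with hH
  set g : ℝ → ℝ := fun s => ∫ z in (-π)..π, dirE ur uθ uz s z with hg
  have hg0 : ∀ r, 0 ≤ g r := fun r =>
    intervalIntegral.integral_nonneg hle (fun z _ => dirE_nonneg _ _ _ _ _)
  have hd' : ∀ r, HasDerivAt H (∫ z in (-π)..π, kfun ur uθ uz p r z) r := fun r =>
    param_deriv _ _ _ _ r (hfun_cont S) (kfun_cont S) (hfun_deriv S)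
  have hd : ∀ r, 0 < r → HasDerivAt H (r * g r) r := fun r hr => by
    rw [← int_kfun S r hr]; exact hd' r
  have h0 : H 0 = 0 := by simp [hH, hfun]
  have hmono : MonotoneOn H (Set.Ici 0) := by
    refine monotoneOn_of_deriv_nonneg (convex_Ici 0)
      (fun x _ => (hd' x).continuousAt.continuousWithinAt)
      (fun x _ => (hd' x).differentiableAt.differentiableWithinAt) (fun x hx => ?_)
    rw [interior_Ici] at hx
    rw [(hd x hx).deriv]
    exact mul_nonneg (le_of_lt hx) (hg0 x)
  have hneg : ∀ r0, max 1 R ≤ r0 → H r0 ≤ 0 := by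
    intro r0 hr0
    have h1 : 1 ≤ r0 := (le_max_left _ _).trans hr0
    have h2 : R ≤ r0 := (le_max_right _ _).trans hr0
    have cψ : Continuous (fun q : ℝ × ℝ => ∫ t in (0:ℝ)..q.2, ur q.1 t) :=
      intervalIntegral.continuous_parametric_primitive_of_continuous S.sr.continuous
    have cψr : Continuous (fun q : ℝ × ℝ => ∫ t in (0:ℝ)..q.2, pdr ur q.1 t) :=
      intervalIntegral.continuous_parametric_primitive_of_continuous
        (pdr_smooth S.sr).continuous
    have cr := (pdr_smooth S.sz).continuous
    have crr := (pdr_smooth (pdr_smooth S.sz)).continuous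
    refine ode_aux H (fun r => ∫ z in (-π)..π, (∫ t in (0:ℝ)..z, ur r t) * pdr uz r z)
      (fun r => ∫ z in (-π)..π, ((∫ t in (0:ℝ)..z, pdr ur r t) * pdr uz r z
          + (∫ t in (0:ℝ)..z, ur r t) * pdr (pdr uz) r z)) g 200 (max E 0) r0 (by norm_num) h1
      (fun r _ => hg0 r) (fun r hr => hd r (by linarith)) ?_ ?_ ?_ ?_
    · intro r _
      refine param_deriv (fun r z => (∫ t in (0:ℝ)..z, ur r t) * pdr uz r z)
        (fun r z => (∫ t in (0:ℝ)..z, pdr ur r t) * pdr uz r z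
          + (∫ t in (0:ℝ)..z, ur r t) * pdr (pdr uz) r z) _ _ r (cψ.mul cr)
        ((cψr.mul cr).add (cψ.mul crr)) (fun s z => ?_)
      exact (param_deriv ur (pdr ur) 0 z s S.sr.continuous (pdr_smooth S.sr).continuous
        (pdr_hasDerivAt S.sr)).mul (pdr_hasDerivAt (pdr_smooth S.sz) s z)
    · intro r hr
      exact (est_main S r (h1.trans hr) (hR r (h2.trans hr)) (g r) rfl).2
    · intro r hr
      exact energy_bound S E hE r (by linarith)
    · intro r hr
      exact (est_main S r (h1.trans hr) (hR r (h2.trans hr)) (g r) rfl).1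
  have hzero : ∀ r, 0 ≤ r → H r = 0 := by
    intro r hr
    apply le_antisymm
    · have hm : r ≤ max r (max 1 R) := le_max_left _ _
      exact (hmono hr (hr.trans hm) hm).trans (hneg _ (le_max_right _ _))
    · rw [← h0]; exact hmono Set.self_mem_Ici hr hr
  have hgz : g r = 0 := by
    have e : H =ᶠ[nhds r] fun _ => 0 := by
      filter_upwards [Ioi_mem_nhds hr] with x hx using hzero x (le_of_lt hx)
    have := (hd r hr).unique ((hasDerivAt_const r (0:ℝ)).congr_of_eventuallyEq e)
    exact (mul_eq_zero.1 this).resolve_left hr.ne'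
  have hz0 : ∀ z ∈ Set.Icc (-π) π, dirE ur uθ uz r z = 0 := by
    intro z hz
    by_contra hne
    have hpos := lt_of_le_of_ne (dirE_nonneg ur uθ uz r z) (Ne.symm hne)
    have := intervalIntegral.integral_pos (by linarith : -π < π) (dirE_cont S r).continuousOn
      (fun x _ => dirE_nonneg ur uθ uz r x) ⟨z, hz, hpos⟩
    exact this.ne' hgz
  have hper : Function.Periodic (fun z => dirE ur uθ uz r z) (2 * π) := by
    intro z
    simp only [dirE, S.pr, S.pθ, pdr_periodic S.pr, pdr_periodic S.pθ, pdr_periodic S.pz,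
      pdz_periodic S.pr, pdz_periodic S.pθ, pdz_periodic S.pz]
  obtain ⟨y, hy, e⟩ := hper.exists_mem_Ioc (by positivity) z (-π)
  rw [e]
  exact hz0 y ⟨hy.1.le, by linarith [hy.2]⟩

/-- A smooth axially symmetric, `2π`-periodic-in-`z` D-solution of ASNS
on `ℝ³` with uniform decay at spatial infinity has bounded velocity and velocity gradient,
with a constant depending only on the uniform local `L⁶` bound `M` of the velocity and on
the Dirichlet integral bound `E`. -/
theorem boundedness_of_velocity_and_gradient :
    ∀ M E : ℝ, ∃ C : ℝ, 0 < C ∧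
      ∀ ur uθ uz p : ℝ → ℝ → ℝ,
        ContDiff ℝ (⊤ : ℕ∞) (fun q : ℝ × ℝ => ur q.1 q.2) →
        ContDiff ℝ (⊤ : ℕ∞) (fun q : ℝ × ℝ => uθ q.1 q.2) →
        ContDiff ℝ (⊤ : ℕ∞) (fun q : ℝ × ℝ => uz q.1 q.2) →
        ContDiff ℝ (⊤ : ℕ∞) (fun q : ℝ × ℝ => p q.1 q.2) →
        (∀ r z : ℝ, ur r (z + 2 * π) = ur r z ∧ uθ r (z + 2 * π) = uθ r z
          ∧ uz r (z + 2 * π) = uz r z ∧ p r (z + 2 * π) = p r z) →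
        ASNS ur uθ uz p Set.univ →
        (∀ ε : ℝ, 0 < ε → ∃ R : ℝ, ∀ r : ℝ, R ≤ r → ∀ z : ℝ,
          |ur r z| + |uθ r z| + |uz r z| < ε) →
        (∫⁻ q in Set.Ioi (0:ℝ) ×ˢ Set.Icc (-π) π,
          ENNReal.ofReal (dirE ur uθ uz q.1 q.2 * q.1) ≤ ENNReal.ofReal E) →
        (∀ x₀ : EuclideanSpace ℝ (Fin 3),
          ∫⁻ x in Metric.ball x₀ 4, ENNReal.ofReal ((mag3 ur uθ uz x) ^ 6)
            ≤ ENNReal.ofReal (M ^ 6)) →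
        (∀ r z : ℝ, 0 ≤ r → |ur r z| + |uθ r z| + |uz r z| ≤ C) ∧
          (∀ r z : ℝ, 0 < r → dirE ur uθ uz r z ≤ C ^ 2) := by
  intro M E
  refine ⟨1, one_pos, ?_⟩
  intro ur uθ uz p sr sθ sz sp hper hns hdec hE _
  have S : SolHyp ur uθ uz p := ⟨sr, sθ, sz, sp, fun r z => (hper r z).1,
    fun r z => (hper r z).2.1, fun r z => (hper r z).2.2.1, fun r z => (hper r z).2.2.2, hns⟩
  have hD : ∀ r z, 0 < r → dirE ur uθ uz r z = 0 := fun r z hr =>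
    dirE_zero S E hdec hE r z hr
  refine ⟨?_, fun r z hr => by rw [hD r z hr]; norm_num⟩
  -- all components are constant in `r` on `(0,∞)`, hence on `[0,∞)`, hence zero by decay
  have hconst : ∀ f : ℝ → ℝ → ℝ, ContDiff ℝ (⊤ : ℕ∞) (fun q : ℝ × ℝ => f q.1 q.2) →
      (∀ r z, 0 < r → pdr f r z = 0) → ∀ r z, 0 ≤ r → f r z = f 0 z := by
    intro f hf h0 r z hr
    rcases hr.eq_or_lt with h | h
    · rw [← h]
    · exact const_aux (fun s => f s z) (fun s => pdr f s z) (fun s => pdr_hasDerivAt hf s z)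
        (fun s hs => h0 s z hs) r h
  have hparts : ∀ r z, 0 < r → pdr ur r z = 0 ∧ pdr uθ r z = 0 ∧ pdr uz r z = 0 := by
    intro r z hr
    have h := hD r z hr
    unfold dirE at h
    have nn : 0 ≤ (ur r z ^ 2 + uθ r z ^ 2) / r ^ 2 := by positivity
    refine ⟨?_, ?_, ?_⟩ <;> refine pow_eq_zero_iff (two_ne_zero) |>.1 (le_antisymm ?_ (sq_nonneg _))
    · nlinarith [sq_nonneg (pdz ur r z), sq_nonneg (pdr uθ r z), sq_nonneg (pdz uθ r z),
        sq_nonneg (pdr uz r z), sq_nonneg (pdz uz r z)]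
    · nlinarith [sq_nonneg (pdz ur r z), sq_nonneg (pdr ur r z), sq_nonneg (pdz uθ r z),
        sq_nonneg (pdr uz r z), sq_nonneg (pdz uz r z)]
    · nlinarith [sq_nonneg (pdz ur r z), sq_nonneg (pdr ur r z), sq_nonneg (pdz uθ r z),
        sq_nonneg (pdr uθ r z), sq_nonneg (pdz uz r z)]
  intro r z hr
  obtain ⟨R, hR⟩ := hdec 1 one_pos
  have h := hR (max R 0) (le_max_left _ _) z
  rw [hconst ur sr (fun r z hr => (hparts r z hr).1) r z hr,
    hconst uθ sθ (fun r z hr => (hparts r z hr).2.1) r z hr,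
    hconst uz sz (fun r z hr => (hparts r z hr).2.2) r z hr,
    ← hconst ur sr (fun r z hr => (hparts r z hr).1) (max R 0) z (le_max_right _ _),
    ← hconst uθ sθ (fun r z hr => (hparts r z hr).2.1) (max R 0) z (le_max_right _ _),
    ← hconst uz sz (fun r z hr => (hparts r z hr).2.2) (max R 0) z (le_max_right _ _)]
  exact h.le
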